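/- Let p ≠ q be primes and Δ ⊂ ℝ^d a d-dimensional Gorenstein simplex of index r with normalized volume pq, not a lattice pyramid, such that the unique interior lattice point of rΔ is the origin. Then the normalized volume of (rΔ)^∨ equals r·p^{s_1+s_3−1}·q^{s_2+s_3−1}, where s_1, s_2, s_3 are the nonnegative integers with s_1+s_2+s_3 = d+1 and rpq = s_1 q + s_2 p + s_3 such that Λ_Δ is generated by the vector with s_1 entries 1/p, s_2 entries 1/q, and s_3 entries 1/(pq). -/

import Mathlib

open scoped BigOperators
open MeasureTheory

noncomputable section

/-- The real point corresponding to a lattice point. -/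
def toReal {d : ℕ} (v : Fin d → ℤ) : Fin d → ℝ := fun i => (v i : ℝ)

/-- The finite abelian group `Λ_Δ ⊆ (ℝ/ℤ)^{d+1}` attached to a lattice simplex with
vertices `v 0, …, v d`. -/
def LambdaSet {d : ℕ} (v : Fin (d + 1) → Fin d → ℤ) :
    Set (Fin (d + 1) → AddCircle (1 : ℝ)) :=
  {lam | ∃ mu : Fin (d + 1) → ℝ,
    (∀ i, ((mu i : ℝ) : AddCircle (1 : ℝ)) = lam i) ∧
    (∀ j, ∃ n : ℤ, ∑ i, mu i * (v i j : ℝ) = (n : ℝ)) ∧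
    (∃ n : ℤ, ∑ i, mu i = (n : ℝ))}

/-- The simplex spanned by the given lattice points. -/
def simplexOf {d : ℕ} (v : Fin (d + 1) → Fin d → ℤ) : Set (Fin d → ℝ) :=
  convexHull ℝ (Set.range fun i => toReal (v i))

/-- The dual (polar) body `{y : ⟨x,y⟩ ≤ 1 ∀ x ∈ P}`. -/
def polarDual {d : ℕ} (P : Set (Fin d → ℝ)) : Set (Fin d → ℝ) :=
  {y | ∀ x ∈ P, ∑ i, x i * y i ≤ 1}

/-- A point of `ℝ^d` is a lattice point if all its coordinates are integers. -/
def IsLatticePoint {d : ℕ} (x : Fin d → ℝ) : Prop := ∀ i, ∃ n : ℤ, x i = (n : ℝ)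

/-- A polytope is reflexive if the origin is its unique interior lattice point and its
dual polytope is again a lattice polytope. -/
def IsReflexive {d : ℕ} (P : Set (Fin d → ℝ)) : Prop :=
  (0 ∈ interior P) ∧
  (∀ x ∈ interior P, IsLatticePoint x → x = 0) ∧
  ∃ V : Finset (Fin d → ℤ), polarDual P = convexHull ℝ (toReal '' (V : Set (Fin d → ℤ)))

/-- A lattice polytope is Gorenstein of index `r` if some lattice translate of its
`r`-th dilate is reflexive. -/
def IsGorenstein {d : ℕ} (P : Set (Fin d → ℝ)) (r : ℕ) : Prop :=
  ∃ w : Fin d → ℤ, IsReflexive ((fun x => (r : ℝ) • x + toReal w) '' P)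

/-- Unimodular equivalence of subsets of `ℝ^d`. -/
def UnimodEquiv {d : ℕ} (P Q : Set (Fin d → ℝ)) : Prop :=
  ∃ (U : Matrix (Fin d) (Fin d) ℤ) (w : Fin d → ℤ), IsUnit U.det ∧
    Q = (fun x => fun j => (∑ i, x i * (U i j : ℝ)) + (w j : ℝ)) '' P

/-- `P` is a lattice pyramid: it is unimodularly equivalent to
`conv(V × {0}, e_j)` for a finite set `V` of lattice points lying in a coordinate
hyperplane. -/
def IsLatticePyramid {d : ℕ} (P : Set (Fin d → ℝ)) : Prop :=
  ∃ (j : Fin d) (V : Finset (Fin d → ℤ)),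
    (∀ x ∈ V, x j = 0) ∧
    UnimodEquiv P (convexHull ℝ
      ((toReal '' (V : Set (Fin d → ℤ))) ∪ {fun i => if i = j then (1 : ℝ) else 0}))

/-- The vertices of the simplex `Δ(A)` associated to `A = (a 1, …, a d)`:
`v 0 = 0`, `v i = e_i` for `1 ≤ i ≤ d-1`, and
`v d = ∑_{j=1}^{d-1} (a d - a j) e_j + (a d) e_d`. -/
def simplexVerts (d : ℕ) (a : ℕ → ℤ) : Fin (d + 1) → Fin d → ℤ := fun i j =>
  if (i : ℕ) = 0 then 0
  else if (i : ℕ) = d then (if (j : ℕ) = d - 1 then a d else a d - a ((j : ℕ) + 1))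
  else if (j : ℕ) + 1 = (i : ℕ) then 1 else 0

/-- The vertices of the simplex `Δ(A,B)`: `v 0 = 0`, `v i = e_i` for
`i ∉ {0, s, d}`, `v s = ∑_{j=1}^s (a j) e_j`, `v d = ∑_{j=1}^d (b j) e_j`. -/
def simplexVerts2 (d s : ℕ) (a b : ℕ → ℤ) : Fin (d + 1) → Fin d → ℤ := fun i j =>
  if (i : ℕ) = 0 then 0
  else if (i : ℕ) = s then (if (j : ℕ) + 1 ≤ s then a ((j : ℕ) + 1) else 0)
  else if (i : ℕ) = d then b ((j : ℕ) + 1)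
  else if (j : ℕ) + 1 = (i : ℕ) then 1 else 0

/-- The element of `(ℝ/ℤ)^{d+1}` with `s₁` entries `1/p`, then `s₂` entries `1/q`,
and remaining entries `1/(pq)`. -/
def genPQ (d s₁ s₂ p q : ℕ) : Fin (d + 1) → AddCircle (1 : ℝ) := fun i =>
  (((if (i : ℕ) < s₁ then 1 / (p : ℝ)
     else if (i : ℕ) < s₁ + s₂ then 1 / (q : ℝ)
     else 1 / ((p : ℝ) * (q : ℝ))) : ℝ) : AddCircle (1 : ℝ))

/-- The corner simplex `{x ≥ 0, ∑ x ≤ t}`. -/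
def cornerSimplex (n : ℕ) (t : ℝ) : Set (Fin n → ℝ) :=
  {x | (∀ i, 0 ≤ x i) ∧ ∑ i, x i ≤ t}

theorem isClosed_cornerSimplex (n : ℕ) (t : ℝ) : IsClosed (cornerSimplex n t) := by
  have h : cornerSimplex n t = (⋂ i, {x | 0 ≤ x i}) ∩ {x | ∑ i, x i ≤ t} := by
    ext x; simp [cornerSimplex]
  rw [h]
  exact (isClosed_iInter fun i => isClosed_le continuous_const (continuous_apply i)).inter
    (isClosed_le (by fun_prop) continuous_const)

theorem volume_cornerSimplex (n : ℕ) {t : ℝ} (ht : 0 ≤ t) :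
    volume (cornerSimplex n t) = ENNReal.ofReal (t ^ n / n.factorial) := by
  induction n generalizing t with
  | zero =>
    have : cornerSimplex 0 t = Set.univ := by ext x; simp [cornerSimplex, ht]
    rw [this]
    simp [volume_pi]
  | succ n ih =>
    have hmp := volume_preserving_piFinSuccAbove (fun _ : Fin (n + 1) => ℝ) 0
    have hm := (isClosed_cornerSimplex (n + 1) t).measurableSet
    rw [← hmp.symm.measure_preimage hm.nullMeasurableSet, Measure.volume_eq_prod,
      Measure.prod_apply ((MeasurableEquiv.measurable _) hm)]
    have hslice (a : ℝ) : volume (Prod.mk a ⁻¹'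
        ((MeasurableEquiv.piFinSuccAbove (fun _ : Fin (n + 1) => ℝ) 0).symm ⁻¹'
          cornerSimplex (n + 1) t)) =
        (Set.Icc 0 t).indicator (fun a => ENNReal.ofReal ((t - a) ^ n / n.factorial)) a := by
      have hmem (y : Fin n → ℝ) : y ∈ Prod.mk a ⁻¹'
        ((MeasurableEquiv.piFinSuccAbove (fun _ : Fin (n + 1) => ℝ) 0).symm ⁻¹'
          cornerSimplex (n + 1) t) ↔ 0 ≤ a ∧ y ∈ cornerSimplex n (t - a) := by
        simp [cornerSimplex, Fin.forall_fin_succ, Fin.sum_univ_succ, le_sub_iff_add_le', and_assoc]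
      by_cases ha : a ∈ Set.Icc 0 t
      · rw [Set.indicator_of_mem ha, ← ih (sub_nonneg.2 ha.2)]
        congr 1
        ext y
        rw [hmem]
        exact and_iff_right ha.1
      · rw [Set.indicator_of_notMem ha]
        convert measure_empty (μ := volume)
        ext y
        rw [hmem]
        simp only [Set.mem_empty_iff_false, iff_false, not_and]
        rintro h0 ⟨h1, h2⟩
        exact ha ⟨h0, sub_nonneg.1 ((Finset.sum_nonneg fun i _ => h1 i).trans h2)⟩
    simp_rw [hslice]
    rw [lintegral_indicator measurableSet_Icc,
      ← ofReal_integral_eq_lintegral_ofReal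
        (ContinuousOn.integrableOn_Icc (by fun_prop))
        ((ae_restrict_iff' measurableSet_Icc).2 (ae_of_all _ fun a ha =>
          div_nonneg (pow_nonneg (sub_nonneg.2 ha.2) _) (by positivity))),
      integral_Icc_eq_integral_Ioc, ← intervalIntegral.integral_of_le ht]
    congr 1
    rw [intervalIntegral.integral_div,
      intervalIntegral.integral_comp_sub_left (fun x : ℝ => x ^ n) t, integral_pow,
      Nat.factorial_succ]
    push_cast
    field_simp
    simp

/-- The matrix whose rows are the edge vectors of the simplex emanating from `v 0`. -/
def edgeMatrix {d : ℕ} (v : Fin (d + 1) → Fin d → ℤ) : Matrix (Fin d) (Fin d) ℤ :=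
  Matrix.of fun i j => v i.succ j - v 0 j

theorem mem_simplexOf_iff {d : ℕ} (v : Fin (d + 1) → Fin d → ℤ) (x : Fin d → ℝ) :
    x ∈ simplexOf v ↔ ∃ w : Fin (d + 1) → ℝ, (∀ i, 0 ≤ w i) ∧ ∑ i, w i = 1 ∧
      ∑ i, w i • toReal (v i) = x := by
  rw [simplexOf, convexHull_range_eq_exists_affineCombination]
  constructor
  · rintro ⟨s, w, hw, hs, rfl⟩
    refine ⟨fun i => if i ∈ s then w i else 0, fun i => ?_, ?_, ?_⟩
    · dsimp only
      split_ifs with h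
      exacts [hw i h, le_rfl]
    · simpa using hs
    · rw [Finset.affineCombination_eq_linear_combination _ _ _ hs]
      simp [ite_smul]
  · rintro ⟨w, hw, hs, rfl⟩
    exact ⟨Finset.univ, w, fun i _ => hw i, hs,
      Finset.affineCombination_eq_linear_combination _ _ _ hs⟩

theorem simplexOf_eq_image_cornerSimplex {d : ℕ} (v : Fin (d + 1) → Fin d → ℤ) :
    simplexOf v = (fun x => toReal (v 0) + x) ''
      (Matrix.toLin' ((edgeMatrix v).map (Int.cast : ℤ → ℝ)).transpose '' cornerSimplex d 1) := by
  ext x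
  rw [mem_simplexOf_iff, Set.image_image]
  have key (w : Fin (d + 1) → ℝ) (hw : ∑ i, w i = 1) : ∑ i, w i • toReal (v i) =
      toReal (v 0) + Matrix.toLin' ((edgeMatrix v).map (Int.cast : ℤ → ℝ)).transpose
        (fun i => w i.succ) := by
    rw [Fin.sum_univ_succ] at hw ⊢
    ext j
    simp only [Pi.add_apply, Pi.smul_apply, Finset.sum_apply, smul_eq_mul, Matrix.toLin'_apply,
      Matrix.mulVec, dotProduct, Matrix.transpose_apply, Matrix.map_apply, edgeMatrix,
      Matrix.of_apply, toReal, Int.cast_sub, sub_mul, Finset.sum_sub_distrib, ← Finset.mul_sum]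
    simp_rw [mul_comm (w _)]
    linear_combination (v 0 j : ℝ) * hw
  constructor
  · rintro ⟨w, hw, hs, rfl⟩
    refine ⟨fun i => w i.succ, ⟨fun i => hw _, ?_⟩, (key w hs).symm⟩
    rw [Fin.sum_univ_succ] at hs
    linarith [hw 0]
  · rintro ⟨y, ⟨hy, hs⟩, rfl⟩
    have h1 : ∑ i, (Fin.cons (1 - ∑ i, y i) y : Fin (d + 1) → ℝ) i = 1 := by
      simp [Fin.sum_univ_succ]
    refine ⟨Fin.cons (1 - ∑ i, y i) y, Fin.forall_fin_succ.2 ⟨?_, ?_⟩, h1, ?_⟩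
    · simpa using hs
    · simpa using hy
    · rw [key _ h1]
      simp

theorem factorial_mul_volume_simplexOf {d : ℕ} (v : Fin (d + 1) → Fin d → ℤ) :
    (Nat.factorial d : ENNReal) * volume (simplexOf v) =
      ENNReal.ofReal |((edgeMatrix v).det : ℝ)| := by
  rw [simplexOf_eq_image_cornerSimplex, Set.image_add_left, measure_preimage_add,
    Measure.addHaar_image_linearMap, volume_cornerSimplex d zero_le_one, LinearMap.det_toLin',
    Matrix.det_transpose, ← ENNReal.ofReal_natCast, ← ENNReal.ofReal_mul (abs_nonneg _),
    ← ENNReal.ofReal_mul (by positivity)]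
  have : ((edgeMatrix v).map (Int.cast : ℤ → ℝ)).det = ((edgeMatrix v).det : ℝ) :=
    (RingHom.map_det (Int.castRingHom ℝ) _).symm
  rw [this]
  congr 1
  have : (d.factorial : ℝ) ≠ 0 := by positivity
  field_simp
  simp

/-- The matrix whose rows are the vertices `v 1, …, v d`. -/
def vertexMatrix {d : ℕ} (v : Fin (d + 1) → Fin d → ℤ) : Matrix (Fin d) (Fin d) ℝ :=
  Matrix.of fun i j => (v i.succ j : ℝ)

theorem det_edgeMatrix_mul {d : ℕ} (v : Fin (d + 1) → Fin d → ℤ) (g : Fin (d + 1) → ℝ)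
    (hg : g 0 ≠ 0) (hz : ∀ j, ∑ i, g i * (v i j : ℝ) = 0) :
    ((edgeMatrix v).det : ℝ) * g 0 = (∑ i, g i) * (vertexMatrix v).det := by
  have h : (edgeMatrix v).map (Int.cast : ℤ → ℝ) =
      (1 + Matrix.replicateCol Unit (fun _ : Fin d => (1 : ℝ)) *
        Matrix.replicateRow Unit (fun j : Fin d => g j.succ / g 0)) * vertexMatrix v := by
    ext i j
    have := hz j
    rw [Fin.sum_univ_succ] at this
    have h2 : ∑ k : Fin d, g k.succ / g 0 * (v k.succ j : ℝ) = - v 0 j := by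
      simp_rw [div_mul_eq_mul_div]
      rw [← Finset.sum_div, div_eq_iff hg]
      linarith
    rw [Matrix.add_mul, Matrix.one_mul, Matrix.add_apply, Matrix.mul_apply]
    simp [edgeMatrix, vertexMatrix, Matrix.mul_apply, h2, sub_eq_add_neg]
  have hdet : ((edgeMatrix v).map (Int.cast : ℤ → ℝ)).det = ((edgeMatrix v).det : ℝ) :=
    (RingHom.map_det (Int.castRingHom ℝ) _).symm
  rw [← hdet, h, Matrix.det_mul, Matrix.det_one_add_replicateCol_mul_replicateRow]
  simp only [dotProduct, mul_one, ← Finset.sum_div, Fin.sum_univ_succ g]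
  field_simp

theorem mem_polarDual_smul_simplexOf_iff {d : ℕ} (v : Fin (d + 1) → Fin d → ℤ) (r : ℝ)
    (y : Fin d → ℝ) : y ∈ polarDual ((fun x => r • x) '' simplexOf v) ↔
      ∀ i, r * ∑ j, (v i j : ℝ) * y j ≤ 1 := by
  simp only [polarDual, Set.forall_mem_image, Set.mem_ofPred_eq, Pi.smul_apply, smul_eq_mul,
    mul_assoc, ← Finset.mul_sum]
  constructor
  · intro h i
    exact h (subset_convexHull ℝ _ ⟨i, rfl⟩)
  · intro h x hx
    obtain ⟨w, hw, hs, rfl⟩ := (mem_simplexOf_iff v x).1 hx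
    calc r * ∑ j, (∑ i, w i • toReal (v i)) j * y j
        = ∑ i, w i * (r * ∑ j, (v i j : ℝ) * y j) := by
          simp only [Finset.sum_apply, Pi.smul_apply, smul_eq_mul, toReal, Finset.sum_mul,
            Finset.mul_sum]
          rw [Finset.sum_comm]
          refine Finset.sum_congr rfl fun i _ => Finset.sum_congr rfl fun j _ => by ring
      _ ≤ ∑ i, w i * 1 := Finset.sum_le_sum fun i _ => mul_le_mul_of_nonneg_left (h i) (hw i)
      _ = 1 := by simpa using hs

theorem factorial_mul_volume_polarDual {d : ℕ} (v : Fin (d + 1) → Fin d → ℤ)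
    (hdet : (edgeMatrix v).det ≠ 0) {r : ℝ} (hr : 0 < r) (g : Fin (d + 1) → ℝ)
    (hg : ∀ i, 0 < g i) (hs : ∑ i, g i = r) (hz : ∀ j, ∑ i, g i * (v i j : ℝ) = 0) :
    (Nat.factorial d : ENNReal) * volume (polarDual ((fun x => r • x) '' simplexOf v)) =
      ENNReal.ofReal (r / (|((edgeMatrix v).det : ℝ)| * ∏ i, g i)) := by
  have hrel := det_edgeMatrix_mul v g (hg 0).ne' hz
  rw [hs] at hrel
  have hV : (vertexMatrix v).det ≠ 0 := by
    intro h
    rw [h, mul_zero] at hrel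
    exact (mul_ne_zero (Int.cast_ne_zero.2 hdet) (hg 0).ne') hrel
  set L : Matrix (Fin d) (Fin d) ℝ :=
    Matrix.diagonal (fun i => -(r * g i.succ)) * vertexMatrix v with hL
  have hLdet : L.det = (∏ i : Fin d, -(r * g i.succ)) * (vertexMatrix v).det := by
    rw [hL, Matrix.det_mul, Matrix.det_diagonal]
  have hL0 : L.det ≠ 0 := by
    rw [hLdet]
    exact mul_ne_zero (Finset.prod_ne_zero_iff.2 fun i _ =>
      neg_ne_zero.2 (mul_pos hr (hg _)).ne') hV
  have hLy (y : Fin d → ℝ) (i : Fin d) :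
      (Matrix.toLin' L y) i = -(r * g i.succ) * ∑ j, (v i.succ j : ℝ) * y j := by
    rw [Matrix.toLin'_apply, hL, ← Matrix.mulVec_mulVec, Matrix.mulVec_diagonal]
    rfl
  have hset : polarDual ((fun x => r • x) '' simplexOf v) =
      Matrix.toLin' L ⁻¹' ((fun x => (fun i => g i.succ) + x) ⁻¹' cornerSimplex d r) := by
    ext y
    rw [mem_polarDual_smul_simplexOf_iff]
    simp only [Set.mem_preimage, cornerSimplex, Set.mem_ofPred_eq, Pi.add_apply, hLy]
    rw [Fin.forall_fin_succ, and_comm]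
    refine and_congr (forall_congr' fun i => ?_) ?_
    · rw [← sub_nonneg, ← mul_nonneg_iff_of_pos_left (hg i.succ)]
      apply iff_of_eq
      congr 1
      ring
    · have h1 : ∑ i, g i * ∑ j, (v i j : ℝ) * y j = 0 := by
        simp_rw [Finset.mul_sum]
        rw [Finset.sum_comm]
        refine Finset.sum_eq_zero fun j _ => ?_
        simp_rw [← mul_assoc]
        rw [← Finset.sum_mul, hz, zero_mul]
      have h2 : ∑ i : Fin d, (g i.succ + -(r * g i.succ) * ∑ j, (v i.succ j : ℝ) * y j) =
          r - g 0 * (1 - r * ∑ j, (v 0 j : ℝ) * y j) := by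
        rw [Fin.sum_univ_succ] at h1 hs
        rw [Finset.sum_add_distrib]
        simp_rw [neg_mul, mul_assoc, Finset.sum_neg_distrib]
        rw [← Finset.mul_sum]
        linear_combination hs - r * h1
      rw [h2, sub_le_self_iff, mul_nonneg_iff_of_pos_left (hg 0), sub_nonneg]
  rw [hset, Measure.addHaar_preimage_linearMap _ (by rwa [LinearMap.det_toLin']),
    measure_preimage_add, volume_cornerSimplex d hr.le, LinearMap.det_toLin',
    ← ENNReal.ofReal_natCast, ← ENNReal.ofReal_mul (abs_nonneg _),
    ← ENNReal.ofReal_mul (by positivity)]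
  congr 1
  have hE : |((edgeMatrix v).det : ℝ)| = r * |(vertexMatrix v).det| / g 0 := by
    have := congrArg abs hrel
    rwa [abs_mul, abs_mul, abs_of_pos (hg 0), abs_of_pos hr, ← eq_div_iff (hg 0).ne'] at this
  have hP : |∏ i : Fin d, -(r * g i.succ)| = r ^ d * ∏ i : Fin d, g i.succ := by
    rw [Finset.abs_prod]
    simp_rw [abs_neg, abs_of_pos (mul_pos hr (hg _))]
    rw [Finset.prod_mul_distrib]
    simp
  have hQ : ∏ i : Fin d, g i.succ ≠ 0 := Finset.prod_ne_zero_iff.2 fun i _ => (hg _).ne'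
  have hV' : |(vertexMatrix v).det| ≠ 0 := abs_ne_zero.2 hV
  have h0 := (hg 0).ne'
  rw [abs_inv, hLdet, abs_mul, hP, hE, Fin.prod_univ_succ]
  have : (d.factorial : ℝ) ≠ 0 := by positivity
  field_simp

/-- A prime dividing the normalized volume divides every integer annihilating `Λ_Δ`. -/
theorem dvd_of_smul_LambdaSet_eq_zero {d : ℕ} (v : Fin (d + 1) → Fin d → ℤ) {p : ℕ}
    (hp : p.Prime) (hdvd : (p : ℤ) ∣ (edgeMatrix v).det) (m : ℤ)
    (hm : ∀ lam ∈ LambdaSet v, m • lam = 0) : (p : ℤ) ∣ m := by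
  have := Fact.mk hp
  have hp0 : (p : ℝ) ≠ 0 := Nat.cast_ne_zero.2 hp.ne_zero
  have hd : ((edgeMatrix v).map (Int.cast : ℤ → ZMod p)).det = 0 :=
    (RingHom.map_det (Int.castRingHom (ZMod p)) _).symm.trans
      ((ZMod.intCast_zmod_eq_zero_iff_dvd _ p).2 hdvd)
  obtain ⟨x, hx0, hx⟩ := Matrix.exists_vecMul_eq_zero_iff.2 hd
  choose y hy using fun i => ZMod.intCast_surjective (x i)
  obtain ⟨i, hi⟩ := Function.ne_iff.1 hx0
  set mu : Fin (d + 1) → ℝ := Fin.cons (-∑ i, (y i : ℝ) / p) (fun i => (y i : ℝ) / p) with hmu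
  have hmem : (fun i => ((mu i : ℝ) : AddCircle (1 : ℝ))) ∈ LambdaSet v := by
    refine ⟨mu, fun _ => rfl, fun j => ?_, 0, ?_⟩
    · have hj : (p : ℤ) ∣ ∑ k, y k * edgeMatrix v k j := by
        rw [← ZMod.intCast_zmod_eq_zero_iff_dvd]
        have := congrFun hx j
        simpa [Matrix.vecMul, dotProduct, ← hy] using this
      obtain ⟨n, hn⟩ := hj
      refine ⟨n, ?_⟩
      have hn' : ∑ k, (y k : ℝ) * ((v k.succ j : ℝ) - v 0 j) = p * n := by
        have := congrArg (Int.cast : ℤ → ℝ) hn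
        simpa [edgeMatrix] using this
      rw [Fin.sum_univ_succ]
      simp only [hmu, Fin.cons_zero, Fin.cons_succ]
      rw [← mul_right_inj' hp0, ← hn', mul_add, neg_mul, Finset.sum_mul, mul_neg, Finset.mul_sum,
        Finset.mul_sum, neg_add_eq_sub, ← Finset.sum_sub_distrib]
      refine Finset.sum_congr rfl fun k _ => ?_
      field_simp
    · rw [Fin.sum_univ_succ]
      simp [hmu]
  have h := congrFun (hm _ hmem) i.succ
  simp only [hmu, Pi.smul_apply, Fin.cons_succ, Pi.zero_apply] at h
  rw [← AddCircle.coe_zsmul, AddCircle.coe_eq_zero_iff] at h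
  obtain ⟨n, hn⟩ := h
  have hn' : (p : ℤ) * n = m * y i := by
    have : (p : ℝ) * n = m * y i := by
      simp only [zsmul_eq_mul, mul_one] at hn
      rw [hn]
      field_simp
    exact_mod_cast this
  refine ((Nat.prime_iff_prime_int.1 hp).dvd_or_dvd ⟨n, hn'.symm⟩).resolve_right fun hyi => hi ?_
  rw [← hy, Pi.zero_apply]
  exact (ZMod.intCast_zmod_eq_zero_iff_dvd _ p).2 hyi

open scoped Pointwise in
theorem sum_smul_mem_interior_smul_simplexOf {d : ℕ} (v : Fin (d + 1) → Fin d → ℤ)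
    (hΔ : AffineIndependent ℝ fun i => toReal (v i)) {r : ℝ} (hr : 0 < r)
    (g : Fin (d + 1) → ℝ) (hg : ∀ i, 0 < g i) (hs : ∑ i, g i = r) :
    ∑ i, g i • toReal (v i) ∈ interior ((fun x => r • x) '' simplexOf v) := by
  have htop : affineSpan ℝ (Set.range fun i => toReal (v i)) = ⊤ :=
    hΔ.affineSpan_eq_top_iff_card_eq_finrank_add_one.2 (by simp)
  let b : AffineBasis (Fin (d + 1)) ℝ (Fin d → ℝ) := ⟨fun i => toReal (v i), hΔ, htop⟩
  have hs' : ∑ i, g i / r = 1 := by rw [← Finset.sum_div, hs, div_self hr.ne']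
  change _ ∈ interior (r • simplexOf v)
  rw [interior_smul₀ hr.ne']
  refine ⟨∑ i, (g i / r) • toReal (v i), ?_, ?_⟩
  · change _ ∈ interior (convexHull ℝ (Set.range b))
    rw [b.interior_convexHull]
    intro i
    have : ∑ i, (g i / r) • toReal (v i) = Finset.univ.affineCombination ℝ b fun i => g i / r :=
      (Finset.affineCombination_eq_linear_combination _ _ _ hs').symm
    rw [this, b.coord_apply_combination_of_mem (Finset.mem_univ i) hs']
    exact div_pos (hg i) hr
  · change r • _ = _
    rw [Finset.smul_sum]
    refine Finset.sum_congr rfl fun i _ => ?_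
    rw [smul_smul, mul_div_cancel₀ _ hr.ne']

theorem sum_mul_isInt_of_coe_mem_LambdaSet {d : ℕ} (v : Fin (d + 1) → Fin d → ℤ)
    (g : Fin (d + 1) → ℝ) (hg : (fun i => (g i : AddCircle (1 : ℝ))) ∈ LambdaSet v) (j : Fin d) :
    ∃ n : ℤ, ∑ i, g i * (v i j : ℝ) = n := by
  obtain ⟨mu, hmu, hv, -⟩ := hg
  obtain ⟨n, hn⟩ := hv j
  have hk (i) : ∃ k : ℤ, g i = mu i + k := by
    have := hmu i
    rw [← sub_eq_zero, ← AddCircle.coe_sub, AddCircle.coe_eq_zero_iff] at this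
    obtain ⟨k, hk⟩ := this
    refine ⟨-k, ?_⟩
    simp only [zsmul_eq_mul, mul_one] at hk
    push_cast
    linarith
  choose k hk using hk
  refine ⟨n + ∑ i, k i * v i j, ?_⟩
  push_cast
  rw [← hn, ← Finset.sum_add_distrib]
  refine Finset.sum_congr rfl fun i _ => ?_
  rw [hk]
  ring

/-- The real vector with `s₁` entries `a`, then `s₂` entries `b`, and remaining entries `c`. -/
def blockVec (d s₁ s₂ : ℕ) (a b c : ℝ) : Fin (d + 1) → ℝ := fun i =>
  if (i : ℕ) < s₁ then a else if (i : ℕ) < s₁ + s₂ then b else c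

theorem blockVec_comp_cast {d s₁ s₂ s₃ : ℕ} (h : s₁ + s₂ + s₃ = d + 1) (a b c : ℝ) :
    (fun i => blockVec d s₁ s₂ a b c (Fin.cast h i)) =
      Fin.append (Fin.append (fun _ : Fin s₁ => a) fun _ : Fin s₂ => b) fun _ : Fin s₃ => c := by
  ext i
  refine Fin.addCases (fun i => Fin.addCases (fun i => ?_) (fun i => ?_) i) (fun i => ?_) i
  all_goals simp [blockVec, Nat.add_assoc]

theorem sum_blockVec {d s₁ s₂ s₃ : ℕ} (h : s₁ + s₂ + s₃ = d + 1) (a b c : ℝ) :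
    ∑ i, blockVec d s₁ s₂ a b c i = s₁ * a + s₂ * b + s₃ * c := by
  rw [← Equiv.sum_comp (finCongr h)]
  have := blockVec_comp_cast h a b c
  simp only [finCongr_apply]
  rw [this]
  simp [Fin.sum_univ_add]

theorem prod_blockVec {d s₁ s₂ s₃ : ℕ} (h : s₁ + s₂ + s₃ = d + 1) (a b c : ℝ) :
    ∏ i, blockVec d s₁ s₂ a b c i = a ^ s₁ * b ^ s₂ * c ^ s₃ := by
  rw [← Equiv.prod_comp (finCongr h)]
  have := blockVec_comp_cast h a b c
  simp only [finCongr_apply]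
  rw [this]
  simp [Fin.prod_univ_add]

/-- for a `d`-dimensional Gorenstein simplex `Δ` of index `r` with
normalized volume `pq` (`p ≠ q` primes), not a lattice pyramid, with the origin the
unique interior lattice point of `rΔ`, and `s₁, s₂, s₃` the parameters with
`s₁+s₂+s₃ = d+1`, `rpq = s₁q + s₂p + s₃` and `Λ_Δ` generated (after reordering the
vertices) by the vector with `s₁` entries `1/p`, `s₂` entries `1/q`, `s₃` entries
`1/(pq)`, the normalized volume of `(rΔ)^∨` is `r·p^{s₁+s₃-1}·q^{s₂+s₃-1}`. -/
theorem statement17 {d : ℕ} (p q : ℕ) (hp : p.Prime) (hq : q.Prime) (hpq : p ≠ q)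
    (v : Fin (d + 1) → Fin d → ℤ)
    (hΔ : AffineIndependent ℝ fun i => toReal (v i))
    (hvol : (Nat.factorial d : ENNReal) * volume (simplexOf v) = ((p * q : ℕ) : ENNReal))
    (hpyr : ¬ IsLatticePyramid (simplexOf v)) (r : ℕ) (hr : 1 ≤ r)
    (hG : IsGorenstein (simplexOf v) r)
    (h0 : (0 : Fin d → ℝ) ∈ interior ((fun x => (r : ℝ) • x) '' simplexOf v))
    (huniq : ∀ x ∈ interior ((fun x => (r : ℝ) • x) '' simplexOf v),
      IsLatticePoint x → x = 0)
    (s₁ s₂ s₃ : ℕ) (hsum : s₁ + s₂ + s₃ = d + 1)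
    (hind : r * p * q = s₁ * q + s₂ * p + s₃)
    (hgen : ∃ σ : Equiv.Perm (Fin (d + 1)),
      LambdaSet (fun i => v (σ i)) = Set.range fun k : ℤ => k • genPQ d s₁ s₂ p q) :
    (Nat.factorial d : ENNReal) *
        volume (polarDual ((fun x => (r : ℝ) • x) '' simplexOf v))
      = ((r * p ^ (s₁ + s₃ - 1) * q ^ (s₂ + s₃ - 1) : ℕ) : ENNReal) := by
  obtain ⟨σ, hσ⟩ := hgen
  set u : Fin (d + 1) → Fin d → ℤ := fun i => v (σ i) with hu
  have hsimp : simplexOf v = simplexOf u := by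
    rw [simplexOf, simplexOf]
    congr 1
    exact (σ.surjective.range_comp fun i => toReal (v i)).symm
  have hu_indep : AffineIndependent ℝ fun i => toReal (u i) :=
    hΔ.comp_embedding σ.toEmbedding
  rw [hsimp] at hvol huniq ⊢
  have hp0 : (0 : ℝ) < p := Nat.cast_pos.2 hp.pos
  have hq0 : (0 : ℝ) < q := Nat.cast_pos.2 hq.pos
  have hr0 : (0 : ℝ) < r := Nat.cast_pos.2 hr
  have hdetR : |((edgeMatrix u).det : ℝ)| = p * q := by
    rw [factorial_mul_volume_simplexOf, ← ENNReal.ofReal_natCast,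
      ENNReal.ofReal_eq_ofReal_iff (abs_nonneg _) (by positivity)] at hvol
    rw [hvol]
    push_cast
    rfl
  have hdet : |(edgeMatrix u).det| = p * q := by exact_mod_cast hdetR
  have hdet0 : (edgeMatrix u).det ≠ 0 := by
    intro h
    rw [h, Int.cast_zero, abs_zero] at hdetR
    exact (mul_pos hp0 hq0).ne hdetR
  set g := blockVec d s₁ s₂ (1 / (p : ℝ)) (1 / (q : ℝ)) (1 / ((p : ℝ) * (q : ℝ))) with hgdef
  have hgen : (fun i => (g i : AddCircle (1 : ℝ))) = genPQ d s₁ s₂ p q := rfl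
  have hg (i) : 0 < g i := by
    simp only [hgdef, blockVec]
    split_ifs <;> positivity
  have hs : ∑ i, g i = r := by
    rw [hgdef, sum_blockVec hsum]
    have : (r : ℝ) * p * q = s₁ * q + s₂ * p + s₃ := by exact_mod_cast hind
    field_simp
    linarith
  have hz : ∑ i, g i • toReal (u i) = 0 := by
    refine huniq _ (sum_smul_mem_interior_smul_simplexOf u hu_indep hr0 g hg hs) fun j => ?_
    have hmem : (fun i => (g i : AddCircle (1 : ℝ))) ∈ LambdaSet u := by
      rw [hσ, hgen]
      exact ⟨1, one_zsmul _⟩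
    simpa [toReal] using sum_mul_isInt_of_coe_mem_LambdaSet u g hmem j
  have hz' (j) : ∑ i, g i * (u i j : ℝ) = 0 := by
    simpa [toReal] using congrFun hz j
  have hkill (m : ℕ) (hm : ∀ i, ∃ n : ℤ, (m : ℝ) * g i = n) :
      ∀ lam ∈ LambdaSet u, (m : ℤ) • lam = 0 := by
    rw [hσ, ← hgen]
    rintro _ ⟨k, rfl⟩
    ext i
    obtain ⟨n, hn⟩ := hm i
    simp only [Pi.smul_apply, Pi.zero_apply]
    rw [smul_comm, ← AddCircle.coe_zsmul, (AddCircle.coe_eq_zero_iff (1 : ℝ)).2 ⟨n, ?_⟩, smul_zero]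
    simpa using hn.symm
  have h13 : 1 ≤ s₁ + s₃ := by
    by_contra! h
    have : (p : ℤ) ∣ (q : ℤ) := by
      refine dvd_of_smul_LambdaSet_eq_zero u hp ((dvd_abs _ _).1 (hdet ▸ Dvd.intro _ rfl)) _
        (hkill q fun i => ⟨1, ?_⟩)
      have := i.isLt
      rw [hgdef, blockVec, if_neg (by omega), if_pos (by omega)]
      field_simp
      simp
    exact hpq ((Nat.prime_dvd_prime_iff_eq hp hq).1 (Int.natCast_dvd_natCast.1 this))
  have h23 : 1 ≤ s₂ + s₃ := by
    by_contra! h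
    have : (q : ℤ) ∣ (p : ℤ) := by
      refine dvd_of_smul_LambdaSet_eq_zero u hq ((dvd_abs _ _).1 (hdet ▸ Dvd.intro_left _ rfl)) _
        (hkill p fun i => ⟨1, ?_⟩)
      have := i.isLt
      rw [hgdef, blockVec, if_pos (by omega)]
      field_simp
      simp
    exact hpq ((Nat.prime_dvd_prime_iff_eq hq hp).1 (Int.natCast_dvd_natCast.1 this)).symm
  rw [factorial_mul_volume_polarDual u hdet0 hr0 g hg hs hz', ← ENNReal.ofReal_natCast]
  congr 1
  rw [hdetR, hgdef, prod_blockVec hsum]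
  obtain ⟨m, hm⟩ := Nat.exists_eq_add_of_le h13
  obtain ⟨n, hn⟩ := Nat.exists_eq_add_of_le h23
  have hP : (p : ℝ) ^ s₁ * (p : ℝ) ^ s₃ = p * p ^ m := by rw [← pow_add, hm, pow_add, pow_one]
  have hQ : (q : ℝ) ^ s₂ * (q : ℝ) ^ s₃ = q * q ^ n := by rw [← pow_add, hn, pow_add, pow_one]
  rw [hm, hn, Nat.add_sub_cancel_left, Nat.add_sub_cancel_left]
  push_cast
  have hprod : (1 / (p : ℝ)) ^ s₁ * (1 / (q : ℝ)) ^ s₂ * (1 / ((p : ℝ) * q)) ^ s₃ =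
      1 / ((p * p ^ m) * (q * q ^ n)) := by
    rw [← hP, ← hQ, one_div_pow, one_div_pow, one_div_pow, mul_pow]
    field_simp
  rw [hprod]
  field_simp
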